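/- Let Δ, a, b, c be integers with Δ ≥ 2, 1 ≤ a ≤ Δ-1, 0 ≤ b ≤ Δ-a and 0 ≤ c ≤ Δ-a. According to the collection of black configurations of Ψ_Δ(a,b,c): the label X is at least as strong as M, the label X is at least as strong as O, the label O is at least as strong as P, and the label P is at least as strong as Z. -/

import Mathlib

/-- The five-element alphabet {M, Z, P, O, X}. -/
inductive Label5 where
  | M | Z | P | O | X
deriving DecidableEq

open Label5

/-- Black configurations of Ψ_Δ(a,b,c) (they only depend on Δ, a, c). -/
def blackPsi (Δ a c : ℕ) (w : Multiset Label5) : Prop :=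
  (∃ s t u, w = s + (t ::ₘ u) ∧ Multiset.card s = a - 1 ∧ (t = M ∨ t = X) ∧
    Multiset.card u = Δ - a ∧ ∀ l ∈ u, l ∈ ({P, O, X} : Finset Label5)) ∨
  (∃ s t u, w = s + t + u ∧ Multiset.card s = a ∧
    Multiset.card t = c ∧ (∀ l ∈ t, l ∈ ({P, O, X} : Finset Label5)) ∧
    Multiset.card u = Δ - a - c ∧ ∀ l ∈ u, l ∈ ({O, X} : Finset Label5)) ∨
  (∃ s u, w = s + (X ::ₘ u) ∧ Multiset.card s = a ∧
    Multiset.card u = Δ - a - 1 ∧ ∀ l ∈ u, l ∈ ({P, O, X} : Finset Label5))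

/-- `L` is at least as strong as `K` according to the collection `B`: replacing
one copy of `K` by `L` in any member of `B` containing `K` yields a member of `B`. -/
def atLeastAsStrong {σ : Type*} [DecidableEq σ] (B : Multiset σ → Prop) (K L : σ) : Prop :=
  ∀ w : Multiset σ, B w → K ∈ w → B (L ::ₘ w.erase K)

/-- Replacing an element of a multiset preserves its cardinality. -/
theorem Multiset.card_cons_erase_of_mem {σ : Type*} [DecidableEq σ] {s : Multiset σ} {K : σ}
    (L : σ) (h : K ∈ s) : Multiset.card (L ::ₘ s.erase K) = Multiset.card s := by
  rw [Multiset.card_cons, Multiset.card_erase_add_one h]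

/-- Replacing an element of a multiset preserves membership in a set of labels that contains the
new label whenever it contains the old one. -/
theorem Multiset.forall_mem_cons_erase {σ : Type*} [DecidableEq σ] {s : Multiset σ} {K L : σ}
    {S : Finset σ} (hS : K ∈ S → L ∈ S) (hK : K ∈ s) (hs : ∀ l ∈ s, l ∈ S) :
    ∀ l ∈ L ::ₘ s.erase K, l ∈ S := by
  intro l hl
  rcases Multiset.mem_cons.1 hl with rfl | hl
  · exact hS (hs K hK)
  · exact hs l (Multiset.mem_of_mem_erase hl)

/-- A label `L` that is allowed at every position of a black configuration where `K` is allowed is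
at least as strong as `K`. -/
theorem atLeastAsStrong_blackPsi {Δ a c : ℕ} {K L : Label5}
    (hPOX : K ∈ ({P, O, X} : Finset Label5) → L ∈ ({P, O, X} : Finset Label5))
    (hOX : K ∈ ({O, X} : Finset Label5) → L ∈ ({O, X} : Finset Label5))
    (hMX : K = M ∨ K = X → L = M ∨ L = X) (hX : K = X → L = X) :
    atLeastAsStrong (blackPsi Δ a c) K L := by
  have key : ∀ {s : Multiset Label5}, K ∈ s → K ::ₘ s.erase K = s := Multiset.cons_erase
  intro w hw hK
  have cancel : ∀ {v : Multiset Label5}, w = K ::ₘ v → L ::ₘ w.erase K = L ::ₘ v := by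
    rintro v rfl
    rw [Multiset.erase_cons_head]
  rcases hw with ⟨s, t, u, hw, hs, ht, hu, hu'⟩ | ⟨s, t, u, hw, hs, ht, ht', hu, hu'⟩ |
    ⟨s, u, hw, hs, hu, hu'⟩
  · left
    have hK' := hK
    rw [hw, Multiset.mem_add, Multiset.mem_cons] at hK'
    rcases hK' with h | rfl | h
    · refine ⟨L ::ₘ s.erase K, t, u, ?_, by rw [Multiset.card_cons_erase_of_mem L h, hs], ht, hu,
        hu'⟩
      rw [Multiset.cons_add]
      exact cancel (by rw [← Multiset.cons_add, key h, hw])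
    · refine ⟨s, L, u, ?_, hs, hMX ht, hu, hu'⟩
      rw [Multiset.add_cons]
      exact cancel (by rw [hw, Multiset.add_cons])
    · refine ⟨s, t, L ::ₘ u.erase K, ?_, hs, ht, by rw [Multiset.card_cons_erase_of_mem L h, hu],
        Multiset.forall_mem_cons_erase hPOX h hu'⟩
      rw [Multiset.cons_swap, Multiset.add_cons]
      exact cancel (by rw [← Multiset.add_cons, Multiset.cons_swap, key h, hw])
  · right; left
    have hK' := hK
    rw [hw, Multiset.mem_add, Multiset.mem_add] at hK'
    rcases hK' with (h | h) | h
    · refine ⟨L ::ₘ s.erase K, t, u, ?_, by rw [Multiset.card_cons_erase_of_mem L h, hs], ht, ht',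
        hu, hu'⟩
      rw [Multiset.cons_add, Multiset.cons_add]
      exact cancel (by rw [← Multiset.cons_add, ← Multiset.cons_add, key h, hw])
    · refine ⟨s, L ::ₘ t.erase K, u, ?_, hs, by rw [Multiset.card_cons_erase_of_mem L h, ht],
        Multiset.forall_mem_cons_erase hPOX h ht', hu, hu'⟩
      rw [Multiset.add_cons, Multiset.cons_add]
      exact cancel (by rw [← Multiset.cons_add, ← Multiset.add_cons, key h, hw])
    · refine ⟨s, t, L ::ₘ u.erase K, ?_, hs, ht, ht',
        by rw [Multiset.card_cons_erase_of_mem L h, hu],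
        Multiset.forall_mem_cons_erase hOX h hu'⟩
      rw [Multiset.add_cons]
      exact cancel (by rw [← Multiset.add_cons, key h, hw])
  · right; right
    have hK' := hK
    rw [hw, Multiset.mem_add, Multiset.mem_cons] at hK'
    rcases hK' with h | h | h
    · refine ⟨L ::ₘ s.erase K, u, ?_, by rw [Multiset.card_cons_erase_of_mem L h, hs], hu, hu'⟩
      rw [Multiset.cons_add]
      exact cancel (by rw [← Multiset.cons_add, key h, hw])
    · refine ⟨s, u, ?_, hs, hu, hu'⟩
      rw [hX h, ← h, Multiset.cons_erase hK, hw, h]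
    · refine ⟨s, L ::ₘ u.erase K, ?_, hs, by rw [Multiset.card_cons_erase_of_mem L h, hu],
        Multiset.forall_mem_cons_erase hPOX h hu'⟩
      rw [Multiset.cons_swap, Multiset.add_cons]
      exact cancel (by rw [← Multiset.add_cons, Multiset.cons_swap, key h, hw])

theorem stmt5 (Δ a b c : ℕ) (hΔ : 2 ≤ Δ) (ha1 : 1 ≤ a) (ha2 : a ≤ Δ - 1)
    (hb : b ≤ Δ - a) (hc : c ≤ Δ - a) :
    atLeastAsStrong (blackPsi Δ a c) M X ∧
    atLeastAsStrong (blackPsi Δ a c) O X ∧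
    atLeastAsStrong (blackPsi Δ a c) P O ∧
    atLeastAsStrong (blackPsi Δ a c) Z P := by
  refine ⟨?_, ?_, ?_, ?_⟩ <;> apply atLeastAsStrong_blackPsi <;> decide
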